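/- arXiv:1912.06909 — 2 statements merged into one kernel-verified Lean document; each statement's English description precedes it below -/
import Mathlib

section
/- For every preference profile P that is single-peaked with respect to ≺, the set of allocations attainable by some sequential priority rule equals the set of allocations attainable by the crawler from some endowment profile: {x : there is an order f on N with SP^f(P) = x} = {x : there is an endowment profile ω with CR(P,ω) = x}. -/
/- Preferences are given by rank functions: `rk i o` is agent `i`'s rank of object `o`
(lower rank = more preferred), so `o P_i o'` iff `rk i o < rk i o'`. -/

/-- Find the smallest index `t` such that the `t`-th agent prefers the `t`-th object
to the `(t+1)`-st object; the last index always qualifies. -/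
def findIdx2 {n : ℕ} (rk : Fin n → Fin n → Fin n) : List (Fin n) → List (Fin n) → ℕ
  | a :: as, o1 :: o2 :: os =>
      if rk a o1 < rk a o2 then 0 else findIdx2 rk as (o2 :: os) + 1
  | _, _ => 0

/-- One run of the (ascending) crawler: `agents` is the list of remaining agents in the
order of their current ownership, `objects` the list of remaining objects in increasing
`≺`-order (the `t`-th agent currently owns the `t`-th object). -/
def crawlAux {n : ℕ} (rk : Fin n → Fin n → Fin n) :
    ℕ → List (Fin n) → List (Fin n) → List (Fin n × Fin n)
  | 0, _, _ => []
  | fuel + 1, agents, objects =>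
    match agents, objects with
    | a0 :: _, o0 :: _ =>
      let t := findIdx2 rk agents objects
      let a := agents.getD t a0
      let ostar := (objects.argmin (rk a)).getD o0
      (a, ostar) :: crawlAux rk fuel (agents.eraseIdx t) (objects.erase ostar)
    | _, _ => []

/-- Agents listed in increasing order of their endowments. -/
def ownersList {n : ℕ} (ω : Fin n → Fin n) : List (Fin n) :=
  (List.finRange n).filterMap fun o => (List.finRange n).find? fun a => ω a == o

/-- The (ascending) crawler allocation. -/
def CRfun {n : ℕ} (rk : Fin n → Fin n → Fin n) (ω : Fin n → Fin n) (i : Fin n) : Fin n :=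
  ((crawlAux rk n (ownersList ω) (List.finRange n)).lookup i).getD (ω i)

/-- The descending crawler: the mirror image of the ascending crawler, obtained by
reversing the order `≺` on objects. -/
def DCRfun {n : ℕ} (rk : Fin n → Fin n → Fin n) (ω : Fin n → Fin n) (i : Fin n) : Fin n :=
  Fin.rev (CRfun (fun j o => rk j o.rev) (fun j => (ω j).rev) i)

/-- Sequential priority: agents in the given list pick, in order, their most
preferred remaining object. -/
def SPAux {n : ℕ} (rk : Fin n → Fin n → Fin n) :
    List (Fin n) → List (Fin n) → List (Fin n × Fin n)
  | [], _ => []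
  | _ :: _, [] => []
  | a :: as, o0 :: os =>
      let o := ((o0 :: os).argmin (rk a)).getD o0
      (a, o) :: SPAux rk as ((o0 :: os).erase o)

/-- The sequential priority rule induced by the order `f` (agent `f k` has priority `k`). -/
def SPfun {n : ℕ} (rk : Fin n → Fin n → Fin n) (f : Fin n → Fin n) (i : Fin n) : Fin n :=
  ((SPAux rk ((List.finRange n).map f) (List.finRange n)).lookup i).getD i

/-- Top trading cycles: `own` maps each remaining object to its (initial) owner. -/
def TTCAux {n : ℕ} (rk : Fin n → Fin n → Fin n) :
    ℕ → List (Fin n) → List (Fin n) → (Fin n → Fin n) → List (Fin n × Fin n)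
  | 0, _, _, _ => []
  | fuel + 1, agents, objects, own =>
    match agents with
    | [] => []
    | a0 :: _ =>
      let top : Fin n → Fin n := fun a => (objects.argmin (rk a)).getD a0
      let ptr : Fin n → Fin n := fun a => own (top a)
      let onCyc : Fin n → Bool := fun a =>
        (List.range agents.length).any fun k => ptr^[k + 1] a == a
      let cyc := agents.filter onCyc
      let assigned := cyc.map top
      (cyc.map fun a => (a, top a)) ++
        TTCAux rk fuel (agents.filter fun a => !onCyc a)
          (objects.filter fun o => !(assigned.contains o)) own

/-- The top trading cycles allocation from endowments `ω`. -/
def TTCfun {n : ℕ} (rk : Fin n → Fin n → Fin n) (ω : Equiv.Perm (Fin n)) (i : Fin n) : Fin n :=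
  ((TTCAux rk n (List.finRange n) (List.finRange n) ω.symm).lookup i).getD (ω i)

/-- A profile of strict preferences (given as rank permutations) is single-peaked
with respect to the order on `Fin n`. -/
def SinglePeaked {n : ℕ} (P : Fin n → Equiv.Perm (Fin n)) : Prop :=
  ∀ i : Fin n, ∃ p : Fin n, ∀ o o' : Fin n,
    ((o' < o ∧ o ≤ p) ∨ (p ≤ o ∧ o < o')) → P i o < P i o'

/-- Pareto efficiency of an allocation `x` at the profile `P`. -/
def ParetoEfficient {n : ℕ} (P : Fin n → Equiv.Perm (Fin n)) (x : Fin n → Fin n) : Prop :=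
  ¬ ∃ y : Equiv.Perm (Fin n),
      (∀ i, P i (y i) ≤ P i (x i)) ∧ ∃ j, P j (y j) < P j (x j)

theorem List.lookup_eq_some_of_mem {α β : Type*} [DecidableEq α] {a : α} {b : β} :
    ∀ {l : List (α × β)}, (l.map Prod.fst).Nodup → (a, b) ∈ l → l.lookup a = some b
  | [], _, h => by simp at h
  | (c, d) :: l, hl, h => by
    rw [List.map_cons, List.nodup_cons] at hl
    rw [List.lookup_cons]
    rcases List.mem_cons.1 h with heq | hmem
    · obtain ⟨rfl, rfl⟩ := Prod.mk.inj heq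
      simp
    · have hne : a ≠ c := by
        rintro rfl
        exact hl.1 (List.mem_map.2 ⟨(a, b), hmem, rfl⟩)
      have hbeq : (a == c) = false := by simpa using hne
      simpa [hbeq] using List.lookup_eq_some_of_mem hl.2 hmem

theorem List.mem_of_lookup_eq_some {α β : Type*} [DecidableEq α] {a : α} {b : β}
    {l : List (α × β)} (h : l.lookup a = some b) : (a, b) ∈ l := by
  obtain ⟨l₁, l₂, rfl, -⟩ := List.lookup_eq_some_iff.1 h
  simp

theorem List.argmin_getD_mem {α β : Type*} [LinearOrder β] (f : α → β) {l : List α}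
    (hl : l ≠ []) (d : α) : (l.argmin f).getD d ∈ l := by
  cases h : l.argmin f with
  | none => exact absurd (List.argmin_eq_none.1 h) hl
  | some m => exact List.argmin_mem h

theorem List.argmin_getD_le {α β : Type*} [LinearOrder β] (f : α → β) {l : List α} {a : α}
    (ha : a ∈ l) (d : α) : f ((l.argmin f).getD d) ≤ f a := by
  cases h : l.argmin f with
  | none => simp [List.argmin_eq_none.1 h] at ha
  | some m => exact List.le_of_mem_argmin ha h

section SequentialPriority

variable {n : ℕ} {rk : Fin n → Fin n → Fin n}

theorem map_fst_SPAux : ∀ (as os : List (Fin n)), as.length = os.length →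
    (SPAux rk as os).map Prod.fst = as
  | [], _, _ => by simp [SPAux]
  | _ :: _, [], h => by simp at h
  | a :: as, o :: os, h => by
    have hmem := List.argmin_getD_mem (rk a) (List.cons_ne_nil o os) o
    simp only [SPAux, List.map_cons]
    rw [map_fst_SPAux as]
    rw [List.length_erase_of_mem hmem]
    simpa using h

theorem snd_mem_of_mem_SPAux : ∀ {as os : List (Fin n)} {p : Fin n × Fin n},
    p ∈ SPAux rk as os → p.2 ∈ os
  | [], _, _, h => by simp [SPAux] at h
  | _ :: _, [], _, h => by simp [SPAux] at h
  | a :: as, o :: os, p, h => by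
    simp only [SPAux, List.mem_cons] at h
    rcases h with rfl | h
    · exact List.argmin_getD_mem (rk a) (List.cons_ne_nil o os) o
    · exact List.mem_of_mem_erase (snd_mem_of_mem_SPAux h)

/-- Under sequential priority, nobody envies an agent who chooses later. -/
theorem pairwise_SPAux (hrk : ∀ i, Function.Injective (rk i)) :
    ∀ (as : List (Fin n)) {os : List (Fin n)}, os.Nodup →
      (SPAux rk as os).Pairwise fun p q => rk p.1 p.2 < rk p.1 q.2
  | [], _, _ => by simp [SPAux]
  | _ :: _, [], _ => by simp [SPAux]
  | a :: as, o :: os, hos => by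
    simp only [SPAux, List.pairwise_cons]
    refine ⟨fun q hq => ?_, pairwise_SPAux hrk as (hos.erase _)⟩
    obtain ⟨hne, hmem⟩ := (List.Nodup.mem_erase_iff hos).1 (snd_mem_of_mem_SPAux hq)
    exact lt_of_le_of_ne (List.argmin_getD_le (rk a) hmem o) fun h => hne (hrk a h).symm

theorem SPfun_no_envy (hrk : ∀ i, Function.Injective (rk i)) (f : Equiv.Perm (Fin n))
    {i j : Fin n} (hij : f.symm i < f.symm j) :
    rk i (SPfun rk f i) < rk i (SPfun rk f j) := by
  have hkeys : (SPAux rk ((List.finRange n).map f) (List.finRange n)).map Prod.fst =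
      (List.finRange n).map f := map_fst_SPAux _ _ (by simp)
  have hnd : ((List.finRange n).map f).Nodup := (List.nodup_finRange n).map f.injective
  have hout : SPAux rk ((List.finRange n).map f) (List.finRange n) =
      ((List.finRange n).map f).map fun a => (a, SPfun rk f a) := by
    conv_rhs => rw [← hkeys, List.map_map]
    conv_lhs => rw [← List.map_id (SPAux rk _ _)]
    refine List.map_congr_left fun p hp => ?_
    have hlook := List.lookup_eq_some_of_mem (a := p.1) (b := p.2) (hkeys.symm ▸ hnd :) hp
    simp [SPfun, hlook]
  have hpw := pairwise_SPAux hrk ((List.finRange n).map f) (List.nodup_finRange n)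
  rw [hout, List.pairwise_map, ← List.ofFn_eq_map, List.pairwise_ofFn] at hpw
  simpa using hpw hij

end SequentialPriority

section Crawler

variable {n : ℕ} {rk : Fin n → Fin n → Fin n}

theorem findIdx2_lt_length (rk : Fin n → Fin n → Fin n) : ∀ {as os : List (Fin n)}, as ≠ [] →
    os.length ≤ as.length → findIdx2 rk as os < as.length
  | [], _, h, _ => absurd rfl h
  | _ :: _, [], _, _ => by simp [findIdx2]
  | _ :: _, [_], _, _ => by simp [findIdx2]
  | [_], _ :: _ :: _, _, h => by simp at h
  | a :: b :: as, o₁ :: o₂ :: os, _, h => by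
    have hlt := findIdx2_lt_length rk (as := b :: as) (os := o₂ :: os) (by simp) (by simpa using h)
    rw [findIdx2]
    split
    · simp
    · simpa using hlt

/-- A run of the crawler is a run of sequential priority in the order of the assignments. -/
theorem crawlAux_spec : ∀ (k : ℕ) (as os : List (Fin n)), as.length = k → os.length = k →
    ((crawlAux rk k as os).map Prod.fst).Perm as ∧
      SPAux rk ((crawlAux rk k as os).map Prod.fst) os = crawlAux rk k as os
  | 0, as, os, ha, _ => by simp [List.length_eq_zero_iff.1 ha, crawlAux, SPAux]
  | k + 1, [], _, ha, _ => by simp at ha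
  | k + 1, _ :: _, [], _, ho => by simp at ho
  | k + 1, a₀ :: as, o₀ :: os, ha, ho => by
    have ht := findIdx2_lt_length rk (as := a₀ :: as) (os := o₀ :: os) (by simp) (by rw [ha, ho])
    have hmem := List.argmin_getD_mem (rk ((a₀ :: as).getD (findIdx2 rk (a₀ :: as) (o₀ :: os)) a₀))
      (List.cons_ne_nil o₀ os) o₀
    simp only [crawlAux]
    obtain ⟨hperm, hSP⟩ := crawlAux_spec k
      ((a₀ :: as).eraseIdx (findIdx2 rk (a₀ :: as) (o₀ :: os)))
      ((o₀ :: os).erase _)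
      (by rw [List.length_eraseIdx_of_lt ht, ha]; rfl)
      (by rw [List.length_erase_of_mem hmem, ho]; rfl)
    refine ⟨?_, ?_⟩
    · rw [List.map_cons]
      refine (hperm.cons _).trans ?_
      rw [List.getD_eq_getElem _ _ ht]
      exact List.getElem_cons_eraseIdx_perm ht
    · rw [List.map_cons, SPAux, hSP]

theorem ownersList_eq_map (ω : Equiv.Perm (Fin n)) :
    ownersList ω = (List.finRange n).map ω.symm := by
  rw [ownersList, ← List.filterMap_eq_map]
  refine List.filterMap_congr fun o _ => ?_
  rw [Function.comp_apply]
  cases h : (List.finRange n).find? fun a => ω a == o with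
  | none => simpa using List.find?_eq_none.1 h (ω.symm o) (List.mem_finRange _)
  | some a =>
    have := List.find?_some h
    simp only [beq_iff_eq] at this
    simp [← this]

theorem exists_SPfun_eq_CRfun (ω : Equiv.Perm (Fin n)) :
    ∃ f : Equiv.Perm (Fin n), SPfun rk f = CRfun rk ω := by
  obtain ⟨hperm, hSP⟩ := crawlAux_spec (rk := rk) n (ownersList ω) (List.finRange n)
    (by simp [ownersList_eq_map]) (by simp)
  set out := crawlAux rk n (ownersList ω) (List.finRange n) with hout
  have hnd : (out.map Prod.fst).Nodup := by
    rw [hperm.nodup_iff, ownersList_eq_map]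
    exact (List.nodup_finRange n).map ω.symm.injective
  have hmem : ∀ i, i ∈ out.map Prod.fst := fun i => by
    rw [hperm.mem_iff, ownersList_eq_map]
    exact List.mem_map.2 ⟨ω i, List.mem_finRange _, ω.symm_apply_apply i⟩
  have hlen : (out.map Prod.fst).length = n := by
    rw [hperm.length_eq, ownersList_eq_map]
    simp
  have hinj : Function.Injective fun k : Fin n => (out.map Prod.fst)[k.1]'(by omega) :=
    fun a b h => Fin.ext (hnd.getElem_inj_iff.1 h)
  refine ⟨Equiv.ofBijective _ (Finite.injective_iff_bijective.1 hinj), funext fun i => ?_⟩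
  have hmap : (List.finRange n).map (fun k : Fin n => (out.map Prod.fst)[k.1]'(by omega)) =
      out.map Prod.fst :=
    List.ext_getElem (by simp [hlen]) (by simp)
  obtain ⟨⟨j, b⟩, hp, rfl⟩ := List.mem_map.1 (hmem i)
  have hlook := List.lookup_eq_some_of_mem hnd hp
  simp only [SPfun, CRfun, Equiv.coe_ofBijective, hmap, hSP, ← hout]
  simp [hlook]

end Crawler

section SinglePeaked

variable {n : ℕ} {P : Fin n → Equiv.Perm (Fin n)}

theorem SinglePeaked.lt_of_lt (hP : SinglePeaked P) {i o₁ o₂ o : Fin n} (h₁₂ : o₁ < o₂)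
    (h : P i o₁ < P i o₂) (ho : o₂ ≤ o) : P i o₁ < P i o := by
  obtain ⟨p, hp⟩ := hP i
  have hp₂ : p ≤ o₂ := by
    by_contra hlt
    exact lt_asymm h (hp o₂ o₁ (Or.inl ⟨h₁₂, (not_le.1 hlt).le⟩))
  rcases ho.eq_or_lt with rfl | ho
  · exact h
  · exact h.trans (hp o₂ o (Or.inr ⟨hp₂, ho⟩))

/-- When the objects are owned according to an allocation `x` without envy towards agents of lower
priority `π`, the agent selected by the crawler precedes all owners to the left, and prefers his
object to all objects to the right. -/
theorem findIdx2_split (hP : SinglePeaked P) {x π : Fin n → Fin n}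
    (hπ : ∀ i j, π i < π j → P i (x i) < P i (x j)) :
    ∀ {as : List (Fin n)}, as ≠ [] → (as.map x).Pairwise (· < ·) →
      ∃ l a r, as = l ++ a :: r ∧
        findIdx2 (fun j => ⇑(P j)) as (as.map x) = l.length ∧
        (∀ b ∈ l, π a ≤ π b) ∧ ∀ b ∈ r, P a (x a) < P a (x b)
  | [], h, _ => absurd rfl h
  | [a], _, _ => ⟨[], a, [], by simp [findIdx2]⟩
  | a :: b :: as, _, hs => by
    by_cases hab : P a (x a) < P a (x b)
    · refine ⟨[], a, b :: as, by simp, by simp [findIdx2, hab], by simp, fun c hc => ?_⟩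
      simp only [List.map_cons, List.pairwise_cons, List.mem_cons, List.mem_map] at hs
      refine hP.lt_of_lt (hs.1 (x b) (Or.inl rfl)) hab ?_
      rcases List.mem_cons.1 hc with rfl | hc
      · exact le_rfl
      · exact (hs.2.1 (x c) ⟨c, hc, rfl⟩).le
    · obtain ⟨l, c, r, heq, hidx, hl, hr⟩ :=
        findIdx2_split hP hπ (as := b :: as) (by simp) (List.pairwise_cons.1 hs).2
      refine ⟨a :: l, c, r, by simp [heq], ?_, fun d hd => ?_, hr⟩
      · simpa [findIdx2, hab] using hidx
      · rcases List.mem_cons.1 hd with rfl | hd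
        · have hba : π b ≤ π d := not_lt.1 fun h => hab (hπ d b h)
          have hb : b ∈ l ++ c :: r := heq ▸ List.mem_cons_self
          cases l with
          | nil =>
            obtain rfl : b = c := by simpa using (List.cons.inj heq).1
            exact hba
          | cons e l =>
            obtain rfl : b = e := by simpa using (List.cons.inj heq).1
            exact (hl b (by simp)).trans hba
        · exact hl d hd

theorem snd_eq_of_mem_crawlAux (hP : SinglePeaked P) {x π : Fin n → Fin n}
    (hx : Function.Injective x) (hπi : Function.Injective π)
    (hπ : ∀ i j, π i < π j → P i (x i) < P i (x j)) :
    ∀ (k : ℕ) {as : List (Fin n)}, (as.map x).Pairwise (· < ·) →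
      ∀ p ∈ crawlAux (fun j => ⇑(P j)) k as (as.map x), p.2 = x p.1
  | 0, _, _, p, hp => by simp [crawlAux] at hp
  | k + 1, [], _, p, hp => by simp [crawlAux] at hp
  | k + 1, a₀ :: as, hs, p, hp => by
    obtain ⟨l, a, r, heq, hidx, hl, hr⟩ := findIdx2_split hP hπ (List.cons_ne_nil a₀ as) hs
    have hget : (a₀ :: as).getD l.length a₀ = a := by simp [heq]
    have htop : (((a₀ :: as).map x).argmin (P a)).getD (x a₀) = x a := by
      have hle := List.argmin_getD_le (P a) (a := x a) (l := (a₀ :: as).map x)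
        (List.mem_map_of_mem (by simp [heq])) (x a₀)
      obtain ⟨b, hb, hbx⟩ := List.mem_map.1
        (List.argmin_getD_mem (P a) (l := (a₀ :: as).map x) (by simp) (x a₀))
      rw [← hbx] at hle ⊢
      by_contra hne
      have hba : b ≠ a := fun h => hne (by rw [h])
      rw [heq, List.mem_append, List.mem_cons] at hb
      rcases hb with hb | hb | hb
      · exact hle.not_gt (hπ a b (lt_of_le_of_ne (hl b hb) fun h => hba (hπi h).symm))
      · exact hba hb
      · exact hle.not_gt (hr b hb)
    have hnd : (l ++ a :: r).Nodup := by
      rw [← heq]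
      exact List.Nodup.of_map x (hs.imp fun h => h.ne)
    have herase : ((a₀ :: as).map x).erase (x a) = ((a₀ :: as).eraseIdx l.length).map x := by
      have hal : a ∉ l := fun h => (List.nodup_append.1 hnd).2.2 a h a (by simp) rfl
      rw [← List.map_erase hx, heq, List.erase_append_right _ hal,
        List.eraseIdx_append_of_length_le le_rfl]
      simp
    rw [List.map_cons, crawlAux, ← List.map_cons] at hp
    simp only [hidx, hget, htop, herase, List.mem_cons] at hp
    rcases hp with rfl | hp
    · rfl
    · exact snd_eq_of_mem_crawlAux hP hx hπi hπ k
        (hs.sublist ((List.eraseIdx_sublist _ _).map x)) p hp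

/-- The crawler leaves an endowment without envy towards lower priorities unchanged. -/
theorem CRfun_eq_self (hP : SinglePeaked P) (x : Equiv.Perm (Fin n)) {π : Fin n → Fin n}
    (hπi : Function.Injective π) (hπ : ∀ i j, π i < π j → P i (x i) < P i (x j)) :
    CRfun (fun j => ⇑(P j)) x = x := by
  have hmap : (ownersList x).map x = List.finRange n := by simp [ownersList_eq_map]
  funext i
  unfold CRfun
  cases h : (crawlAux (fun j => ⇑(P j)) n (ownersList x) (List.finRange n)).lookup i with
  | none => rfl
  | some b =>
    have hmem := List.mem_of_lookup_eq_some h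
    rw [← hmap] at hmem
    refine snd_eq_of_mem_crawlAux hP x.injective hπi hπ n ?_ _ hmem
    rw [hmap]
    exact List.pairwise_lt_finRange n

end SinglePeaked

/-- the set of allocations attainable by some sequential priority rule
equals the set of allocations attainable by the crawler from some endowment profile. -/
theorem range_sequential_priority_eq_range_crawler {n : ℕ} (hn : 1 ≤ n)
    (P : Fin n → Equiv.Perm (Fin n)) (hP : SinglePeaked P) :
    {x : Fin n → Fin n | ∃ f : Equiv.Perm (Fin n), SPfun (fun j => ⇑(P j)) ⇑f = x} =
      {x : Fin n → Fin n | ∃ ω : Equiv.Perm (Fin n), CRfun (fun j => ⇑(P j)) ⇑ω = x} := by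
  ext x
  constructor
  · rintro ⟨f, rfl⟩
    have henvy : ∀ i j, f.symm i < f.symm j →
        P i (SPfun (fun j => ⇑(P j)) f i) < P i (SPfun (fun j => ⇑(P j)) f j) :=
      fun _ _ => SPfun_no_envy (fun i => (P i).injective) f
    have hinj : Function.Injective (SPfun (fun j => ⇑(P j)) f) := fun i j hij => by
      rcases lt_trichotomy (f.symm i) (f.symm j) with h | h | h
      · exact absurd (henvy i j h) (by simp [hij])
      · exact f.symm.injective h
      · exact absurd (henvy j i h) (by simp [hij])
    exact ⟨Equiv.ofBijective _ (Finite.injective_iff_bijective.1 hinj),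
      CRfun_eq_self hP (Equiv.ofBijective _ _) f.symm.injective henvy⟩
  · rintro ⟨ω, rfl⟩
    exact exists_SPfun_eq_CRfun ω
end

section
/- For every strict preference profile P, the set of allocations attainable by some sequential priority rule equals the set of allocations attainable by Top Trading Cycles from some endowment profile: {x : there is an order f on N with SP^f(P) = x} = {x : there is an endowment profile ω with TTC^ω(P) = x}. -/
open Function

/-- The most preferred object of `a` in `objects`, with default value `d`. -/
def favorite {n : ℕ} (rk : Fin n → Fin n → Fin n) (objects : List (Fin n)) (d a : Fin n) :
    Fin n :=
  (objects.argmin (rk a)).getD d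

/-- Whether `a` returns to itself after at most `m` steps of `ptr`. -/
def onCycle {n : ℕ} (m : ℕ) (ptr : Fin n → Fin n) (a : Fin n) : Bool :=
  (List.range m).any fun k => ptr^[k + 1] a == a

/-- Each agent in the order `f` prefers his assignment to those of all later agents. -/
def PicksInOrder {n : ℕ} (rk : Fin n → Fin n → Fin n) (f x : Fin n → Fin n) : Prop :=
  ∀ k l, k < l → rk (f k) (x (f k)) < rk (f k) (x (f l))

section Favorite

variable {n : ℕ} {rk : Fin n → Fin n → Fin n} {objects : List (Fin n)}

theorem argmin_eq_favorite (h : objects ≠ []) (d a : Fin n) :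
    objects.argmin (rk a) = some (favorite rk objects d a) := by
  unfold favorite
  cases hm : objects.argmin (rk a) with
  | none => exact absurd (List.argmin_eq_none.1 hm) h
  | some o => rfl

theorem favorite_mem (h : objects ≠ []) (d a : Fin n) : favorite rk objects d a ∈ objects :=
  List.argmin_mem (argmin_eq_favorite h d a)

theorem rank_favorite_le {o : Fin n} (ho : o ∈ objects) (d a : Fin n) :
    rk a (favorite rk objects d a) ≤ rk a o :=
  List.le_of_mem_argmin ho (argmin_eq_favorite (List.ne_nil_of_mem ho) d a)

theorem rank_favorite_lt (hrk : ∀ i, Injective (rk i)) {o : Fin n} (ho : o ∈ objects)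
    {d a : Fin n} (hne : favorite rk objects d a ≠ o) :
    rk a (favorite rk objects d a) < rk a o :=
  (rank_favorite_le ho d a).lt_of_ne fun h => hne (hrk a h)

end Favorite

theorem List.lookup_eq_some_of_mem_s10 {α β : Type*} [DecidableEq α] {L : List (α × β)}
    (h : (L.map Prod.fst).Nodup) {p : α × β} (hp : p ∈ L) : L.lookup p.1 = some p.2 := by
  induction L with
  | nil => simp at hp
  | cons q L ih =>
    rw [List.map_cons, List.nodup_cons] at h
    rw [List.lookup_cons]
    rcases List.mem_cons.1 hp with rfl | hp
    · simp
    · have : p.1 ≠ q.1 := fun e => h.1 (e ▸ List.mem_map_of_mem hp)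
      rw [beq_false_of_ne this]
      exact ih h.2 hp

theorem exists_picksInOrder_lookup {n : ℕ} {rk : Fin n → Fin n → Fin n}
    {L : List (Fin n × Fin n)} (hL : (L.map Prod.fst).Perm (List.finRange n))
    (hR : L.Pairwise fun p q => rk p.1 p.2 < rk p.1 q.2) (d : Fin n → Fin n) :
    ∃ f : Equiv.Perm (Fin n), PicksInOrder rk f fun i => (L.lookup i).getD (d i) := by
  have hnd : (L.map Prod.fst).Nodup := hL.nodup_iff.2 (List.nodup_finRange n)
  have hlen : L.length = n := by simpa using hL.length_eq
  have hval : ∀ k : Fin L.length,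
      (L.lookup (L.get k).1).getD (d (L.get k).1) = (L.get k).2 := fun k => by
    rw [List.lookup_eq_some_of_mem_s10 hnd (L.get_mem k), Option.getD_some]
  have hinj : Injective fun k : Fin n => (L.get (k.cast hlen.symm)).1 := by
    intro k l h
    have := (List.nodup_iff_injective_get.1 hnd)
      (a₁ := k.cast (by simp [hlen])) (a₂ := l.cast (by simp [hlen])) (by simpa using h)
    simpa [Fin.ext_iff] using this
  refine ⟨Equiv.ofBijective _ hinj.bijective_of_finite, fun k l hkl => ?_⟩
  simp only [Equiv.ofBijective_apply]
  rw [hval, hval]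
  exact List.pairwise_iff_get.1 hR _ _ hkl

section SequentialPriority

variable {n : ℕ} {rk : Fin n → Fin n → Fin n}

theorem SPAux_cons (a : Fin n) (as : List (Fin n)) {objects : List (Fin n)}
    (h : objects ≠ []) :
    SPAux rk (a :: as) objects = (a, favorite rk objects a a) ::
      SPAux rk as (objects.erase (favorite rk objects a a)) := by
  obtain ⟨o, os, rfl⟩ := List.exists_cons_of_ne_nil h
  have : favorite rk (o :: os) a a = ((o :: os).argmin (rk a)).getD o := by
    rw [argmin_eq_favorite h a a, Option.getD_some]
  rw [this]
  rfl

theorem SPAux_spec (hrk : ∀ i, Injective (rk i)) (agents objects : List (Fin n))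
    (hlen : agents.length = objects.length) (hnd : objects.Nodup) :
    (SPAux rk agents objects).map Prod.fst = agents ∧
      (∀ p ∈ SPAux rk agents objects, p.2 ∈ objects) ∧
      (SPAux rk agents objects).Pairwise fun p q => rk p.1 p.2 < rk p.1 q.2 := by
  induction agents generalizing objects with
  | nil => simp [SPAux]
  | cons a as ih =>
    have hne : objects ≠ [] := by rintro rfl; simp at hlen
    have hmem := favorite_mem (rk := rk) hne a a
    obtain ⟨h₁, h₂, h₃⟩ := ih (objects.erase (favorite rk objects a a))
      (by rw [List.length_erase_of_mem hmem, ← hlen]; simp) (hnd.erase _)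
    rw [SPAux_cons a as hne]
    refine ⟨by simp [h₁], ?_, List.pairwise_cons.2 ⟨fun q hq => ?_, h₃⟩⟩
    · simp only [List.mem_cons, forall_eq_or_imp]
      exact ⟨hmem, fun p hp => List.mem_of_mem_erase (h₂ p hp)⟩
    · obtain ⟨hq₁, hq₂⟩ := hnd.mem_erase_iff.1 (h₂ q hq)
      exact rank_favorite_lt hrk hq₂ hq₁.symm

theorem SPAux_eq_map (x : Fin n → Fin n) (agents objects : List (Fin n))
    (hobj : objects.Perm (agents.map x))
    (hx : agents.Pairwise fun a b => rk a (x a) < rk a (x b)) :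
    SPAux rk agents objects = agents.map fun a => (a, x a) := by
  induction agents generalizing objects with
  | nil => simp [SPAux]
  | cons a as ih =>
    obtain ⟨hxa, hxas⟩ := List.pairwise_cons.1 hx
    have hmem : x a ∈ objects := hobj.mem_iff.2 (by simp)
    have hne := List.ne_nil_of_mem hmem
    have hfav : favorite rk objects a a = x a := by
      have hle := rank_favorite_le (rk := rk) hmem a a
      have := hobj.mem_iff.1 (favorite_mem (rk := rk) hne a a)
      rw [List.map_cons, List.mem_cons, List.mem_map] at this
      rcases this with h | ⟨b, hb, h⟩
      · exact h
      · rw [← h] at hle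
        exact absurd (hxa b hb) hle.not_gt
    rw [SPAux_cons a as hne, hfav, ih _ _ hxas, List.map_cons]
    simpa using hobj.erase (x a)

theorem exists_picksInOrder_SPfun (hrk : ∀ i, Injective (rk i)) (f : Equiv.Perm (Fin n)) :
    ∃ g : Equiv.Perm (Fin n), PicksInOrder rk g (SPfun rk f) := by
  obtain ⟨h₁, -, h₃⟩ := SPAux_spec hrk ((List.finRange n).map f) (List.finRange n)
    (by simp) (List.nodup_finRange n)
  refine exists_picksInOrder_lookup ?_ h₃ id
  rw [h₁]
  exact Equiv.Perm.map_finRange_perm f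

theorem SPfun_eq_of_picksInOrder {f x : Equiv.Perm (Fin n)} (h : PicksInOrder rk f x) :
    SPfun rk f = x := by
  funext i
  have hf := Equiv.Perm.map_finRange_perm f
  have hL := SPAux_eq_map (rk := rk) x ((List.finRange n).map f) (List.finRange n)
    ((hf.map x).trans (Equiv.Perm.map_finRange_perm x)).symm
    (List.pairwise_map.2 ((List.pairwise_lt_finRange n).imp fun hkl => h _ _ hkl))
  rw [SPfun, hL, List.lookup_eq_some_of_mem_s10 (p := (i, x i)), Option.getD_some]
  · simpa [Function.comp_def] using (List.nodup_finRange n).map f.injective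
  · exact List.mem_map_of_mem (hf.mem_iff.2 (List.mem_finRange i))

end SequentialPriority

section TopTradingCycles

variable {n : ℕ} {rk : Fin n → Fin n → Fin n}

theorem TTCAux_cons (fuel : ℕ) (a₀ : Fin n) (as objects : List (Fin n))
    (own : Fin n → Fin n) :
    let top := favorite rk objects a₀
    let c := onCycle (a₀ :: as).length fun a => own (top a)
    let cyc := (a₀ :: as).filter c
    TTCAux rk (fuel + 1) (a₀ :: as) objects own =
      (cyc.map fun a => (a, top a)) ++ TTCAux rk fuel ((a₀ :: as).filter fun a => !c a)
        (objects.filter fun o => !((cyc.map top).contains o)) own :=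
  rfl

theorem onCycle_iff {agents : List (Fin n)} {ptr : Fin n → Fin n}
    (hptr : ∀ a, ptr a ∈ agents) (a : Fin n) :
    onCycle agents.length ptr a = true ↔ a ∈ periodicPts ptr := by
  simp only [onCycle, List.any_eq_true, List.mem_range, beq_iff_eq]
  constructor
  · rintro ⟨k, -, hk⟩
    exact ⟨k + 1, k.succ_pos, hk⟩
  · intro ha
    have hpos := minimalPeriod_pos_of_mem_periodicPts ha
    have hle : minimalPeriod ptr a ≤ agents.length := by
      calc minimalPeriod ptr a = (Finset.range (minimalPeriod ptr a)).card := by simp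
        _ ≤ agents.toFinset.card := by
          refine Finset.card_le_card_of_injOn (fun k => ptr^[k + 1] a) (fun k _ => ?_) ?_
          · simp only [iterate_succ_apply', Finset.mem_coe, List.mem_toFinset]
            exact hptr _
          · intro k hk l hl h
            simp only [Finset.coe_range, Set.mem_Iio] at hk hl
            simp only [iterate_succ_apply'] at h
            refine iterate_injOn_Iio_minimalPeriod hk hl ((bijOn_periodicPts ptr).injOn ?_ ?_ h)
            · exact (bijOn_periodicPts ptr).mapsTo.iterate k ha
            · exact (bijOn_periodicPts ptr).mapsTo.iterate l ha
        _ ≤ agents.length := List.toFinset_card_le _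
    refine ⟨minimalPeriod ptr a - 1, by omega, ?_⟩
    rw [Nat.sub_add_cancel hpos]
    exact iterate_minimalPeriod

theorem exists_mem_periodicPts {α : Type*} [Finite α] (g : α → α) (a : α) :
    ∃ b, b ∈ periodicPts g := by
  obtain ⟨i, j, hij, h⟩ := Finite.exists_ne_map_eq_of_infinite fun k : ℕ => g^[k] a
  wlog hlt : i < j generalizing i j
  · exact this j i hij.symm h.symm (by omega)
  refine ⟨g^[i] a, j - i, by omega, ?_⟩
  rw [IsPeriodicPt, IsFixedPt, ← iterate_add_apply, Nat.sub_add_cancel hlt.le]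
  exact h.symm

/-- The remaining objects are exactly the endowments of the remaining agents. -/
def Owned (ω : Equiv.Perm (Fin n)) (agents objects : List (Fin n)) : Prop :=
  ∀ o, o ∈ objects ↔ ω.symm o ∈ agents

theorem Owned.ne_nil {ω : Equiv.Perm (Fin n)} {a : Fin n} {agents objects : List (Fin n)}
    (h : Owned ω agents objects) (ha : a ∈ agents) : objects ≠ [] :=
  List.ne_nil_of_mem ((h (ω a)).2 (by simpa using ha))

theorem Owned.remove_cycles {ω : Equiv.Perm (Fin n)} {agents objects : List (Fin n)}
    (h : Owned ω agents objects) {top : Fin n → Fin n} (htop : ∀ a, top a ∈ objects) :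
    let c := onCycle agents.length fun a => ω.symm (top a)
    Owned ω (agents.filter fun a => !c a)
      (objects.filter fun o => !(((agents.filter c).map top).contains o)) := by
  intro c o
  have hc := onCycle_iff (ptr := fun a => ω.symm (top a)) fun a => (h _).1 (htop a)
  simp only [List.mem_filter, h o, and_congr_right_iff, Bool.not_eq_true', ← Bool.not_eq_true,
    not_iff_not, List.contains_iff_mem, List.mem_map]
  intro _
  rw [hc]
  constructor
  · rintro ⟨a, ⟨-, ha⟩, rfl⟩
    exact (bijOn_periodicPts _).mapsTo ((hc a).1 ha)
  · intro ho
    obtain ⟨a, ha, hao⟩ := (bijOn_periodicPts fun a => ω.symm (top a)).surjOn ho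
    refine ⟨a, ⟨?_, (hc a).2 ha⟩, ω.symm.injective hao⟩
    obtain ⟨b, -, rfl⟩ := (bijOn_periodicPts fun a => ω.symm (top a)).surjOn ha
    exact (h _).1 (htop b)

theorem TTCAux_spec (hrk : ∀ i, Injective (rk i)) (ω : Equiv.Perm (Fin n)) (fuel : ℕ)
    (agents objects : List (Fin n)) (hfuel : agents.length ≤ fuel) (hnd : agents.Nodup)
    (hown : Owned ω agents objects) :
    ((TTCAux rk fuel agents objects ω.symm).map Prod.fst).Perm agents ∧
      (∀ p ∈ TTCAux rk fuel agents objects ω.symm, p.2 ∈ objects) ∧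
      (TTCAux rk fuel agents objects ω.symm).Pairwise
        fun p q => rk p.1 p.2 < rk p.1 q.2 := by
  induction fuel generalizing agents objects with
  | zero =>
    obtain rfl : agents = [] := List.length_eq_zero_iff.1 (by omega)
    simp [TTCAux]
  | succ fuel ih =>
    cases agents with
    | nil => simp [TTCAux]
    | cons a₀ as =>
      rw [TTCAux_cons]
      have htop := favorite_mem (rk := rk) (hown.ne_nil (List.mem_cons_self ..)) a₀
      have hnext := hown.remove_cycles htop
      set top := favorite rk objects a₀
      have hc := onCycle_iff (ptr := fun a => ω.symm (top a)) fun a => (hown _).1 (htop a)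
      set c := onCycle (a₀ :: as).length fun a => ω.symm (top a)
      have hlt : ((a₀ :: as).filter fun a => !c a).length < (a₀ :: as).length := by
        obtain ⟨b, hb⟩ := exists_mem_periodicPts (fun a => ω.symm (top a)) a₀
        refine List.length_filter_lt_length_iff_exists.2 ⟨ω.symm (top b), ?_, ?_⟩
        · exact (hown _).1 (htop b)
        · simpa using (hc _).2 ((bijOn_periodicPts _).mapsTo hb)
      obtain ⟨h₁, h₂, h₃⟩ := ih _ _ (by omega) (hnd.filter _) hnext
      refine ⟨?_, ?_, List.pairwise_append.2 ⟨?_, h₃, ?_⟩⟩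
      · rw [List.map_append, List.map_map]
        simp only [Function.comp_def, List.map_id']
        exact (h₁.append_left _).trans (List.filter_append_perm c _)
      · intro p hp
        rcases List.mem_append.1 hp with hp | hp
        · obtain ⟨a, -, rfl⟩ := List.mem_map.1 hp
          exact htop a
        · exact (List.mem_filter.1 (h₂ p hp)).1
      · rw [List.pairwise_map]
        refine (hnd.filter c).imp_of_mem fun {a b} ha hb hab => ?_
        refine rank_favorite_lt hrk (htop b) fun h => hab ?_
        exact (bijOn_periodicPts fun a => ω.symm (top a)).injOn
          ((hc a).1 (List.mem_filter.1 ha).2) ((hc b).1 (List.mem_filter.1 hb).2)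
          (congrArg ω.symm h)
      · intro p hp q hq
        obtain ⟨a, ha, rfl⟩ := List.mem_map.1 hp
        obtain ⟨hq₁, hq₂⟩ := List.mem_filter.1 (h₂ q hq)
        refine rank_favorite_lt hrk hq₁ fun h => ?_
        simp only [Bool.not_eq_true', ← Bool.not_eq_true, List.contains_iff_mem] at hq₂
        exact hq₂ (h ▸ List.mem_map_of_mem ha)

theorem exists_picksInOrder_TTCfun (hrk : ∀ i, Injective (rk i)) (ω : Equiv.Perm (Fin n)) :
    ∃ f : Equiv.Perm (Fin n), PicksInOrder rk f (TTCfun rk ω) := by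
  obtain ⟨h₁, -, h₃⟩ := TTCAux_spec hrk ω n (List.finRange n) (List.finRange n)
    (by simp) (List.nodup_finRange n) (fun o => by simp)
  exact exists_picksInOrder_lookup h₁ h₃ ω

theorem eq_of_mem_periodicPts_of_rank_le {α : Type*} {g : α → α} {r : α → ℕ} {s : Set α}
    (hr : Injective r) (hs : ∀ a, g a ∈ s) (hle : ∀ a ∈ s, r (g a) ≤ r a) {a : α}
    (ha : a ∈ periodicPts g) : g a = a := by
  have hiter : ∀ k, ∀ b ∈ s, r (g^[k] b) ≤ r b := by
    intro k
    induction k with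
    | zero => exact fun b _ => le_rfl
    | succ k ih => exact fun b hb => (ih _ (hs b)).trans (hle b hb)
  obtain ⟨m, hm, hma⟩ := ha
  obtain ⟨m, rfl⟩ := Nat.exists_eq_succ_of_ne_zero hm.ne'
  have hga : g^[m] (g a) = a := hma
  have has : a ∈ s := by
    have h : g^[m + 1] a = a := hma
    rw [iterate_succ_apply'] at h
    exact h ▸ hs _
  refine hr (le_antisymm (hle a has) ?_)
  simpa [hga] using hiter m (g a) (hs a)

theorem snd_eq_of_mem_TTCAux {f x : Equiv.Perm (Fin n)} (hx : PicksInOrder rk f x) (fuel : ℕ)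
    (agents objects : List (Fin n)) (hown : Owned x agents objects) :
    ∀ p ∈ TTCAux rk fuel agents objects x.symm, p.2 = x p.1 := by
  induction fuel generalizing agents objects with
  | zero => simp [TTCAux]
  | succ fuel ih =>
    cases agents with
    | nil => simp [TTCAux]
    | cons a₀ as =>
      rw [TTCAux_cons]
      have htop := favorite_mem (rk := rk) (hown.ne_nil (List.mem_cons_self ..)) a₀
      have hnext := hown.remove_cycles htop
      have hc := onCycle_iff (ptr := fun a => x.symm (favorite rk objects a₀ a))
        fun a => (hown _).1 (htop a)
      intro p hp
      rcases List.mem_append.1 hp with hp | hp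
      · obtain ⟨a, ha, rfl⟩ := List.mem_map.1 hp
        have hper := (hc a).1 (List.mem_filter.1 ha).2
        have hfix := eq_of_mem_periodicPts_of_rank_le (r := fun b => (f.symm b : ℕ))
          (s := {b | b ∈ a₀ :: as}) (Fin.val_injective.comp f.symm.injective)
          (fun b => (hown _).1 (htop b)) (fun b hb => ?_) hper
        · exact (Equiv.symm_apply_eq x).1 hfix
        · by_contra! hlt
          have hpref := hx _ _ (Fin.lt_def.2 hlt)
          simp only [Equiv.apply_symm_apply] at hpref
          refine hpref.not_ge (rank_favorite_le ((hown _).2 ?_) _ _)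
          simpa using hb
      · exact ih _ _ hnext p hp

theorem TTCfun_eq_of_picksInOrder {f x : Equiv.Perm (Fin n)} (hx : PicksInOrder rk f x) :
    TTCfun rk x = x := by
  funext i
  unfold TTCfun
  cases hl : (TTCAux rk n (List.finRange n) (List.finRange n) x.symm).lookup i with
  | none => rfl
  | some o =>
    obtain ⟨l₁, l₂, hL, -⟩ := List.lookup_eq_some_iff.1 hl
    exact snd_eq_of_mem_TTCAux hx n (List.finRange n) (List.finRange n) (fun o => by simp)
      (i, o) (by simp [hL])

end TopTradingCycles

theorem PicksInOrder.injective {n : ℕ} {rk : Fin n → Fin n → Fin n} {f : Equiv.Perm (Fin n)}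
    {x : Fin n → Fin n} (h : PicksInOrder rk f x) : Injective x := by
  have hxf : Injective (x ∘ f) := Injective.of_lt_imp_ne fun k l hkl e =>
    (h k l hkl).ne (congrArg (rk (f k)) e)
  simpa [Function.comp_assoc] using hxf.comp f.symm.injective

/-- for every strict preference profile, the set of allocations
attainable by some sequential priority rule equals the set of allocations attainable
by TTC from some endowment profile. -/
theorem range_sequential_priority_eq_range_ttc {n : ℕ} (hn : 1 ≤ n)
    (P : Fin n → Equiv.Perm (Fin n)) :
    {x : Fin n → Fin n | ∃ f : Equiv.Perm (Fin n), SPfun (fun j => ⇑(P j)) ⇑f = x} =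
      {x : Fin n → Fin n | ∃ ω : Equiv.Perm (Fin n), TTCfun (fun j => ⇑(P j)) ω = x} := by
  have hrk : ∀ i, Injective ((fun j => ⇑(P j)) i) := fun i => (P i).injective
  ext x
  constructor
  · rintro ⟨f, rfl⟩
    obtain ⟨g, hg⟩ := exists_picksInOrder_SPfun hrk f
    refine ⟨Equiv.ofBijective _ hg.injective.bijective_of_finite, ?_⟩
    exact TTCfun_eq_of_picksInOrder (f := g) hg
  · rintro ⟨ω, rfl⟩
    obtain ⟨g, hg⟩ := exists_picksInOrder_TTCfun hrk ω
    refine ⟨g, ?_⟩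
    exact SPfun_eq_of_picksInOrder
      (x := Equiv.ofBijective _ hg.injective.bijective_of_finite) hg
end
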